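/- arXiv:2010.12386 — 2 statements merged into one kernel-verified Lean document; each statement's English description precedes it below -/
import Mathlib

section
/- Addition formula for Fibonacci divisor numbers: for all integers k ≥ 1 and natural numbers n, m with m ≥ 1, F_{n+m}^{(k)} = F_m^{(k)} · F_{n+1}^{(k)} + (−1)^{k+1} · F_n^{(k)} · F_{m−1}^{(k)}; equivalently, in ℤ: F_{(n+m)k} · F_k = F_{mk} · F_{(n+1)k} + (−1)^{k+1} · F_{nk} · F_{(m−1)k}. -/
theorem aux_add (s t : ℕ) : (Nat.fib (s + t) : ℤ) =
    Nat.fib s * Nat.fib (t + 1) + Nat.fib (s + 1) * Nat.fib t - Nat.fib s * Nat.fib t := by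
  have h1 := Nat.fib_add s (t + 1)
  have h2 := Nat.fib_add s t
  have h3 := Nat.fib_add_two (n := s + t)
  have h4 := Nat.fib_add_two (n := t)
  rw [show s + (t + 1) + 1 = s + t + 2 by ring, h3, h2, h4] at h1
  zify at h1
  linear_combination h1

theorem aux_cassini (k : ℕ) : (Nat.fib (k + 1) : ℤ) ^ 2 - Nat.fib k * Nat.fib (k + 1)
    - (Nat.fib k : ℤ) ^ 2 = (-1) ^ k := by
  induction k with
  | zero => simp
  | succ k ih =>
    rw [Nat.fib_add_two, pow_succ (-1 : ℤ) k, ← ih]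
    push_cast
    ring

theorem aux_main (a b k : ℕ) : (Nat.fib (a + b + k) : ℤ) * Nat.fib k =
    Nat.fib (b + k) * Nat.fib (a + k) + (-1) ^ (k + 1) * Nat.fib a * Nat.fib b := by
  have h2 : (Nat.fib (a + b + 1) : ℤ) =
      Nat.fib a * Nat.fib b + Nat.fib (a + 1) * Nat.fib (b + 1) := by
    exact_mod_cast Nat.fib_add a b
  rw [aux_add (a + b) k, aux_add a b, aux_add b k, aux_add a k, h2, pow_succ, ← aux_cassini k]
  ring

/-- Addition formula for Fibonacci divisor numbers: for k ≥ 1 and m ≥ 1,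
    F_{n+m}^{(k)} = F_m^{(k)} F_{n+1}^{(k)} + (−1)^{k+1} F_n^{(k)} F_{m−1}^{(k)}
    (as an identity of rationals, where F_n^{(k)} = F_{nk}/F_k), equivalently in ℤ:
    F_{(n+m)k} · F_k = F_{mk} · F_{(n+1)k} + (−1)^{k+1} · F_{nk} · F_{(m−1)k}. -/
theorem fib_divisor_addition_formula (k n m : ℕ) (hk : 1 ≤ k) (hm : 1 ≤ m) :
    ((Nat.fib ((n + m) * k) : ℚ) / (Nat.fib k : ℚ) =
      ((Nat.fib (m * k) : ℚ) / (Nat.fib k : ℚ)) *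
        ((Nat.fib ((n + 1) * k) : ℚ) / (Nat.fib k : ℚ)) +
      (-1 : ℚ) ^ (k + 1) * ((Nat.fib (n * k) : ℚ) / (Nat.fib k : ℚ)) *
        ((Nat.fib ((m - 1) * k) : ℚ) / (Nat.fib k : ℚ))) ∧
    ((Nat.fib ((n + m) * k) : ℤ) * Nat.fib k =
      (Nat.fib (m * k) : ℤ) * Nat.fib ((n + 1) * k) +
        (-1) ^ (k + 1) * Nat.fib (n * k) * Nat.fib ((m - 1) * k)) := by
  have key : ((Nat.fib ((n + m) * k) : ℤ) * Nat.fib k =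
      (Nat.fib (m * k) : ℤ) * Nat.fib ((n + 1) * k) +
        (-1) ^ (k + 1) * Nat.fib (n * k) * Nat.fib ((m - 1) * k)) := by
    obtain ⟨j, rfl⟩ : ∃ j, m = j + 1 := ⟨m - 1, by omega⟩
    have h := aux_main (n * k) (j * k) k
    rw [show (n + (j + 1)) * k = n * k + j * k + k by ring, show (j + 1) * k = j * k + k by ring,
      show (n + 1) * k = n * k + k by ring, Nat.add_sub_cancel]
    exact h
  refine ⟨?_, key⟩
  have hk0 : (Nat.fib k : ℚ) ≠ 0 := by
    have : 0 < Nat.fib k := Nat.fib_pos.2 hk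
    positivity
  have keyQ := congrArg (Int.cast : ℤ → ℚ) key
  push_cast at keyQ
  field_simp
  linear_combination keyQ
end

section
/- Pascal-type recursion for k-th Fibonomials: for every integer k ≥ 1 and all natural numbers n, m with 1 ≤ m ≤ n − 1, the k-th Fibonomial coefficients satisfy [n m]_k = φ'^{km} · [n−1 m]_k + φ^{k(n−m)} · [n−1 m−1]_k, as an identity of real numbers. -/
noncomputable def gphi : ℝ := (1 + Real.sqrt 5) / 2
noncomputable def gphi' : ℝ := (1 - Real.sqrt 5) / 2

/-- The Fibonacci divisor factorial F_n^{(k)}! = ∏_{i=1}^n F_i^{(k)},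
    where F_i^{(k)} = F_{ik}/F_k (empty product 1 for n = 0). -/
noncomputable def fibDivFact (k n : ℕ) : ℝ :=
  ∏ i ∈ Finset.range n, ((Nat.fib ((i + 1) * k) : ℝ) / (Nat.fib k : ℝ))

/-- The k-th Fibonomial coefficient [n m]_k = F_n^{(k)}! / (F_m^{(k)}! F_{n−m}^{(k)}!). -/
noncomputable def fibonomial (k n m : ℕ) : ℝ :=
  fibDivFact k n / (fibDivFact k m * fibDivFact k (n - m))

theorem fibDivFact_succ' (k n : ℕ) : fibDivFact k (n + 1) =
    fibDivFact k n * ((Nat.fib ((n + 1) * k) : ℝ) / (Nat.fib k : ℝ)) := by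
  simp only [fibDivFact, Finset.prod_range_succ]

theorem fibDivFact_ne (k n : ℕ) (hk : 1 ≤ k) : fibDivFact k n ≠ 0 := by
  unfold fibDivFact
  refine Finset.prod_ne_zero_iff.mpr fun i _ => ?_
  have h1 : 0 < Nat.fib k := Nat.fib_pos.mpr hk
  have h2 : 0 < Nat.fib ((i + 1) * k) := Nat.fib_pos.mpr (by positivity)
  positivity

theorem fib_split (p q : ℕ) : (Nat.fib (p + q) : ℝ) =
    gphi' ^ p * Nat.fib q + gphi ^ q * Nat.fib p := by
  have e1 : gphi = Real.goldenRatio := rfl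
  have e2 : gphi' = Real.goldenConj := rfl
  rw [e1, e2, Real.coe_fib_eq, Real.coe_fib_eq, Real.coe_fib_eq]
  ring

/-- Pascal-type recursion for k-th Fibonomials: for k ≥ 1 and 1 ≤ m ≤ n − 1,
    [n m]_k = φ'^{km} [n−1 m]_k + φ^{k(n−m)} [n−1 m−1]_k. -/
theorem fibonomial_recursion (k n m : ℕ) (hk : 1 ≤ k) (hm : 1 ≤ m) (hmn : m ≤ n - 1) :
    fibonomial k n m =
      gphi' ^ (k * m) * fibonomial k (n - 1) m +
        gphi ^ (k * (n - m)) * fibonomial k (n - 1) (m - 1) := by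
  obtain ⟨a, rfl⟩ : ∃ a, m = a + 1 := ⟨m - 1, by omega⟩
  obtain ⟨b, rfl⟩ : ∃ b, n = a + b + 2 := ⟨n - a - 2, by omega⟩
  have h1 : a + b + 2 - 1 = a + b + 1 := by omega
  have h2 : a + b + 2 - (a + 1) = b + 1 := by omega
  have h3 : a + b + 1 - (a + 1) = b := by omega
  have h4 : a + b + 1 - a = b + 1 := by omega
  have hs := fib_split (k * (a + 1)) (k * (b + 1))
  have h5 : k * (a + 1) + k * (b + 1) = (a + b + 1 + 1) * k := by ring
  rw [h5] at hs
  have hf : (Nat.fib k : ℝ) ≠ 0 := by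
    have : 0 < Nat.fib k := Nat.fib_pos.mpr hk
    positivity
  have ha : (Nat.fib (k * (a + 1)) : ℝ) ≠ 0 := by
    have : 0 < Nat.fib (k * (a + 1)) := Nat.fib_pos.mpr (by positivity)
    positivity
  have hb : (Nat.fib (k * (b + 1)) : ℝ) ≠ 0 := by
    have : 0 < Nat.fib (k * (b + 1)) := Nat.fib_pos.mpr (by positivity)
    positivity
  have hA := fibDivFact_ne k a hk
  have hB := fibDivFact_ne k b hk
  unfold fibonomial
  rw [h1, h2, h3, Nat.add_sub_cancel, h4, fibDivFact_succ' k (a + b + 1), fibDivFact_succ' k a,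
    fibDivFact_succ' k b, hs, mul_comm (a + 1) k, mul_comm (b + 1) k]
  generalize fibDivFact k (a + b + 1) = N
  generalize gphi' ^ (k * (a + 1)) = x at *
  generalize gphi ^ (k * (b + 1)) = y at *
  field_simp
end
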